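/- For n ≥ 1 let |ψ_n⟩ be the normalization of |0⟩^⊗n + |+⟩^⊗n, where |+⟩ = (|0⟩+|1⟩)/√2, and set ρ_n = |ψ_n⟩⟨ψ_n|. Then the number of tensor-product Pauli operators P ∈ {I,X,Y,Z}^⊗n with P ≠ I^⊗n and Tr(ρ_n·P) ≠ 0 is at least 3^n − 1. In particular, since |ψ_n⟩ is a linear combination of two stabilizer states, the Pauli rank of |ψ_n⟩ exceeds its stabilizer rank exponentially in n. -/

import Mathlib

open Matrix Complex

noncomputable section

/-- An `n`-qubit operator: a matrix indexed by binary strings of length `n`. -/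
abbrev QOp (n : ℕ) := Matrix (Fin n → Fin 2) (Fin n → Fin 2) ℂ

/-- The single-qubit Pauli `X` matrix. -/
def PauliX : Matrix (Fin 2) (Fin 2) ℂ := !![0, 1; 1, 0]

/-- The single-qubit Pauli `Y` matrix. -/
def PauliY : Matrix (Fin 2) (Fin 2) ℂ := !![0, -Complex.I; Complex.I, 0]

/-- The single-qubit Pauli `Z` matrix. -/
def PauliZ : Matrix (Fin 2) (Fin 2) ℂ := !![1, 0; 0, -1]

/-- The tensor product of single-qubit operators, one per qubit. -/
def tensorOp {n : ℕ} (σ : Fin n → Matrix (Fin 2) (Fin 2) ℂ) : QOp n :=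
  fun x y => ∏ i, σ i (x i) (y i)

/-- A matrix is unitary. -/
def IsUnitary {m : Type*} [Fintype m] [DecidableEq m] (U : Matrix m m ℂ) : Prop :=
  U * Uᴴ = 1 ∧ Uᴴ * U = 1

/-- Membership in the `n`-qubit Pauli group: a phase in `{1, -1, i, -i}` times a
tensor product of single-qubit Pauli matrices (including the identity). -/
def IsPauli {n : ℕ} (P : QOp n) : Prop :=
  ∃ (γ : ℂ) (σ : Fin n → Matrix (Fin 2) (Fin 2) ℂ),
    (γ = 1 ∨ γ = -1 ∨ γ = Complex.I ∨ γ = -Complex.I) ∧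
    (∀ i, σ i = 1 ∨ σ i = PauliX ∨ σ i = PauliY ∨ σ i = PauliZ) ∧
    P = γ • tensorOp σ

/-- An `n`-qubit Clifford unitary: conjugation preserves the Pauli group. -/
def IsClifford {n : ℕ} (U : QOp n) : Prop :=
  IsUnitary U ∧ ∀ P : QOp n, IsPauli P → IsPauli (U * P * Uᴴ)

/-- The Clifford hierarchy: level 1 is the Pauli group; for `k ≥ 2`, level `k`
consists of the unitaries conjugating every Pauli into level `k - 1`. -/
def CliffordLevel {n : ℕ} : ℕ → QOp n → Prop
  | 0, _ => False
  | 1, V => IsPauli V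
  | (k+2), V => IsUnitary V ∧ ∀ P : QOp n, IsPauli P → CliffordLevel (k+1) (V * P * Vᴴ)

/-- The controlled gate `C(U) = |0⟩⟨0| ⊗ I + |1⟩⟨1| ⊗ U`, with the control on qubit `0`. -/
def controlled {n : ℕ} (U : QOp n) : QOp (n+1) :=
  fun x y =>
    if x 0 = y 0 then
      (if x 0 = 0 then (if Fin.tail x = Fin.tail y then 1 else 0)
       else U (Fin.tail x) (Fin.tail y))
    else 0

/-- The tensor product `a ⊗ A` of a single-qubit operator `a` (on the control qubit `0`)
with an `n`-qubit operator `A` (on the register). -/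
def tensorWith {n : ℕ} (a : Matrix (Fin 2) (Fin 2) ℂ) (A : QOp n) : QOp (n+1) :=
  fun x y => a (x 0) (y 0) * A (Fin.tail x) (Fin.tail y)

/-- `A` acts trivially on qubit `i`: it is block-diagonal in the qubit-`i` basis and its
entries do not depend on the (common) value of the `i`-th coordinate. -/
def actsTriviallyOn {n : ℕ} (A : QOp n) (i : Fin n) : Prop :=
  (∀ x y, x i ≠ y i → A x y = 0) ∧
  (∀ x y (c c' : Fin 2),
    A (Function.update x i c) (Function.update y i c) =
      A (Function.update x i c') (Function.update y i c'))

/-- The support of an operator: the set of qubits on which it acts nontrivially. -/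
def Supp {n : ℕ} (A : QOp n) : Set (Fin n) := {i | ¬ actsTriviallyOn A i}

/-- A Pauli-Square-Root Clifford: a non-Pauli Clifford whose square is a Pauli. -/
def IsPSC {n : ℕ} (C : QOp n) : Prop := IsClifford C ∧ ¬ IsPauli C ∧ IsPauli (C * C)

/-- Two operators either commute or anticommute. -/
def CommOrAnticomm {n : ℕ} (A B : QOp n) : Prop := A * B = B * A ∨ A * B = -(B * A)


/-- The four single-qubit Pauli matrices `I, X, Y, Z` indexed by `Fin 4`. -/
def pauliOf : Fin 4 → Matrix (Fin 2) (Fin 2) ℂ := ![1, PauliX, PauliY, PauliZ]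

/-- The `n`-qubit computational basis state `|0⟩^⊗n`. -/
def e0 (n : ℕ) : (Fin n → Fin 2) → ℂ := fun x => if x = 0 then 1 else 0

/-- The `n`-qubit `|+⟩^⊗n` state. -/
def plusVec (n : ℕ) : (Fin n → Fin 2) → ℂ := fun _ => ((Real.sqrt 2 : ℂ))⁻¹ ^ n

/-- The embedding of `I, X, Z` into the four Pauli labels. -/
def g3 : Fin 3 → Fin 4 := ![0, 1, 3]

def n00 : Fin 3 → ℕ := ![1, 0, 1]

def nTot : Fin 3 → ℕ := ![2, 2, 0]

lemma g3_inj : Function.Injective g3 := by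
  decide

lemma p00 (a : Fin 3) : pauliOf (g3 a) 0 0 = (n00 a : ℂ) := by
  fin_cases a <;> simp [pauliOf, g3, n00, PauliX, PauliZ]

lemma pRow (a : Fin 3) : ∑ b, pauliOf (g3 a) 0 b = 1 := by
  fin_cases a <;> simp [pauliOf, g3, PauliX, PauliZ]

lemma pCol (a : Fin 3) : ∑ b, pauliOf (g3 a) b 0 = 1 := by
  fin_cases a <;> simp [pauliOf, g3, PauliX, PauliZ]

lemma pTot (a : Fin 3) : ∑ b, ∑ c, pauliOf (g3 a) b c = (nTot a : ℂ) := by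
  fin_cases a <;> simp [pauliOf, g3, nTot, PauliX, PauliZ] <;> norm_num

lemma t00 {n : ℕ} (t : Fin n → Fin 3) :
    tensorOp (fun i => pauliOf (g3 (t i))) 0 0 = ((∏ i, n00 (t i) : ℕ) : ℂ) := by
  simp [tensorOp, p00]

lemma tRow {n : ℕ} (t : Fin n → Fin 3) :
    ∑ y, tensorOp (fun i => pauliOf (g3 (t i))) 0 y = 1 := by
  have := (Fintype.prod_sum (fun (i : Fin n) (b : Fin 2) => pauliOf (g3 (t i)) 0 b)).symm
  simp only [pRow, Finset.prod_const_one] at this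
  exact this

lemma tCol {n : ℕ} (t : Fin n → Fin 3) :
    ∑ y, tensorOp (fun i => pauliOf (g3 (t i))) y 0 = 1 := by
  have := (Fintype.prod_sum (fun (i : Fin n) (b : Fin 2) => pauliOf (g3 (t i)) b 0)).symm
  simp only [pCol, Finset.prod_const_one] at this
  exact this

lemma tTot {n : ℕ} (t : Fin n → Fin 3) :
    ∑ x, ∑ y, tensorOp (fun i => pauliOf (g3 (t i))) x y = ((∏ i, nTot (t i) : ℕ) : ℂ) := by
  have h := (Fintype.prod_sum
    (fun (i : Fin n) (b : Fin 2) => ∑ c, pauliOf (g3 (t i)) b c)).symm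
  simp only [pTot] at h
  rw [Nat.cast_prod, ← h]
  refine Finset.sum_congr rfl fun x _ => ?_
  exact (Fintype.prod_sum (fun (i : Fin n) (c : Fin 2) => pauliOf (g3 (t i)) (x i) c)).symm

lemma quad {n : ℕ} (T : QOp n) (p : ℂ) :
    ∑ x, ∑ y, (e0 n x + p) * (e0 n y + p) * T y x
      = T 0 0 + p * (∑ y, T 0 y) + p * (∑ y, T y 0) + p ^ 2 * ∑ x, ∑ y, T x y := by
  have h : ∀ x y, (e0 n x + p) * (e0 n y + p) * T y x
      = e0 n x * (e0 n y * T y x) + e0 n x * (p * T y x) + p * (e0 n y * T y x)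
        + p ^ 2 * T y x := by
    intro x y; ring
  simp only [h, Finset.sum_add_distrib, ← Finset.mul_sum]
  rw [Finset.sum_comm (f := fun x y => T y x)]
  simp [e0]
  ring

lemma trace_ne {n : ℕ} (t : Fin n → Fin 3) (c p : ℝ) (hc : c ≠ 0) (hp : 0 < p)
    (ψ : (Fin n → Fin 2) → ℂ) (hψ : ∀ x, ψ x = (c : ℂ) * (e0 n x + p)) :
    (Matrix.vecMulVec ψ (star ψ) * tensorOp (fun i => pauliOf (g3 (t i)))).trace ≠ 0 := by
  have hs : ∀ x, star (ψ x) = (c : ℂ) * (e0 n x + p) := by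
    intro x
    rw [hψ]
    by_cases hx : x = 0 <;> simp [e0, hx]
  have key : (Matrix.vecMulVec ψ (star ψ) * tensorOp (fun i => pauliOf (g3 (t i)))).trace
      = ((c ^ 2 * ((∏ i, n00 (t i) : ℕ) + p + p + p ^ 2 * (∏ i, nTot (t i) : ℕ)) : ℝ) : ℂ) := by
    have h1 := quad (tensorOp (fun i => pauliOf (g3 (t i)))) (p : ℂ)
    rw [t00, tRow, tCol, tTot] at h1
    have h2 : (Matrix.vecMulVec ψ (star ψ) * tensorOp (fun i => pauliOf (g3 (t i)))).trace
        = (c : ℂ) ^ 2 * ∑ x, ∑ y, (e0 n x + p) * (e0 n y + p) *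
          tensorOp (fun i => pauliOf (g3 (t i))) y x := by
      simp only [Matrix.trace, Matrix.diag, Matrix.mul_apply, Matrix.vecMulVec_apply,
        Pi.star_apply, Finset.mul_sum]
      refine Finset.sum_congr rfl fun x _ => Finset.sum_congr rfl fun y _ => ?_
      rw [hs, hψ]
      ring
    rw [h2, h1]
    push_cast
    ring
  rw [key]
  have : 0 < c ^ 2 * (((∏ i, n00 (t i) : ℕ) : ℝ) + p + p + p ^ 2 * (∏ i, nTot (t i) : ℕ)) := by
    positivity
  exact_mod_cast this.ne'

/-- For `n ≥ 1`, let `|ψₙ⟩` be the normalization of `|0⟩^⊗n + |+⟩^⊗n` and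
`ρₙ = |ψₙ⟩⟨ψₙ|`. Then at least `3^n - 1` nontrivial tensor-product Pauli strings `P` satisfy
`Tr(ρₙ P) ≠ 0`. -/
theorem pauli_rank_lower_bound (n : ℕ) (hn : 1 ≤ n) :
    letI v : (Fin n → Fin 2) → ℂ := fun x => e0 n x + plusVec n x
    letI ψ : (Fin n → Fin 2) → ℂ :=
      ((Real.sqrt (∑ x, Complex.normSq (v x)) : ℂ))⁻¹ • v
    3 ^ n - 1 ≤ Set.ncard {s : Fin n → Fin 4 | s ≠ 0 ∧
        (Matrix.vecMulVec ψ (star ψ) * tensorOp (fun i => pauliOf (s i))).trace ≠ 0} := by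
  let v : (Fin n → Fin 2) → ℂ := fun x => e0 n x + plusVec n x
  let ψ : (Fin n → Fin 2) → ℂ := ((Real.sqrt (∑ x, Complex.normSq (v x)) : ℂ))⁻¹ • v
  change 3 ^ n - 1 ≤ Set.ncard {s : Fin n → Fin 4 | s ≠ 0 ∧
        (Matrix.vecMulVec ψ (star ψ) * tensorOp (fun i => pauliOf (s i))).trace ≠ 0}
  have hp : 0 < ((Real.sqrt 2)⁻¹ ^ n : ℝ) := by positivity
  set p : ℝ := (Real.sqrt 2)⁻¹ ^ n with hpdef
  have hv : ∀ x, v x = e0 n x + (p : ℂ) := by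
    intro x
    simp [v, plusVec, hpdef]
  have hpos : 0 < ∑ x, Complex.normSq (v x) := by
    refine Finset.sum_pos' (fun x _ => Complex.normSq_nonneg _) ⟨0, Finset.mem_univ _, ?_⟩
    rw [Complex.normSq_pos, hv]
    have : (1 + p : ℝ) ≠ 0 := by positivity
    simp only [e0, if_true]
    exact_mod_cast this
  have hc : (Real.sqrt (∑ x, Complex.normSq (v x)))⁻¹ ≠ 0 :=
    inv_ne_zero (Real.sqrt_pos.2 hpos).ne'
  have hψ : ∀ x, ψ x = (((Real.sqrt (∑ x, Complex.normSq (v x)))⁻¹ : ℝ) : ℂ) * (e0 n x + p) := by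
    intro x
    rw [← hv, Complex.ofReal_inv]
    rfl
  have hinj : Function.Injective (fun (t : Fin n → Fin 3) (i : Fin n) => g3 (t i)) :=
    fun a b h => funext fun i => g3_inj (congrFun h i)
  have hcard : Set.ncard ((fun (t : Fin n → Fin 3) (i : Fin n) => g3 (t i)) '' {0}ᶜ)
      = 3 ^ n - 1 := by
    rw [Set.ncard_image_of_injective _ hinj, Set.ncard_compl]
    simp
  rw [← hcard]
  refine Set.ncard_le_ncard ?_ (Set.toFinite _)
  rintro _ ⟨t, ht, rfl⟩
  refine ⟨fun h => ht ?_, trace_ne t _ p hc hp ψ hψ⟩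
  exact hinj (h.trans (by funext i; rfl))

end
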